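/- For every natural number k, the odd complex Clifford algebra ℂl_{2k+1} is isomorphic as a ℂ-algebra to the product algebra M_{2^k}(ℂ) × M_{2^k}(ℂ). -/

import Mathlib

/-- The quadratic form `z₁² + ⋯ + z_n²` on `ℂⁿ`. -/
noncomputable def Qc (n : ℕ) : QuadraticForm ℂ (Fin n → ℂ) :=
  QuadraticMap.weightedSumSquares ℂ (fun _ : Fin n => (1 : ℂ))

/-- A family of pairwise anticommuting square roots of `1` generating the algebra `A`. -/
structure IsCliffordSystem {ι A : Type*} [Ring A] [Algebra ℂ A] (γ : ι → A) : Prop where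
  sq : ∀ i, γ i * γ i = 1
  anticomm : ∀ i j, i ≠ j → γ i * γ j = -(γ j * γ i)
  adjoin_range : Algebra.adjoin ℂ (Set.range γ) = ⊤

/-- A square root of `1` anticommuting with every member of the family `γ`. -/
structure IsChirality {ι A : Type*} [Ring A] (γ : ι → A) (ω : A) : Prop where
  sq : ω * ω = 1
  anticomm : ∀ i, ω * γ i = -(γ i * ω)

section Transfer

variable {ι A B : Type*} [Ring A] [Algebra ℂ A] [Ring B] [Algebra ℂ B]

theorem IsCliffordSystem.map {γ : ι → A} (h : IsCliffordSystem γ) (e : A ≃ₐ[ℂ] B) :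
    IsCliffordSystem (fun i => e (γ i)) where
  sq i := by rw [← map_mul, h.sq, map_one]
  anticomm i j hij := by rw [← map_mul, h.anticomm i j hij, map_neg, map_mul]
  adjoin_range := by
    have := congrArg (Subalgebra.map e.toAlgHom) h.adjoin_range
    rw [AlgHom.map_adjoin, ← Set.range_comp, Algebra.map_top] at this
    refine Eq.trans this ?_
    exact (AlgHom.range_eq_top _).2 e.surjective

theorem IsChirality.map {γ : ι → A} {ω : A} (h : IsChirality γ ω) (e : A ≃ₐ[ℂ] B) :
    IsChirality (fun i => e (γ i)) (e ω) where
  sq := by rw [← map_mul, h.sq, map_one]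
  anticomm i := by rw [← map_mul, h.anticomm i, map_neg, map_mul]

end Transfer

section Doubling

variable {A : Type*} [Ring A] [Algebra ℂ A] {n : ℕ}

/-- Extend a family in `A` by two generators in the `2 × 2` matrices over `A`, by means of the
Pauli matrices. -/
noncomputable def pauliExtend (γ : Fin n → A) : Fin (n + 2) → Matrix (Fin 2) (Fin 2) A :=
  Fin.cons !![0, 1; 1, 0] (Fin.cons !![0, -(Complex.I • 1); Complex.I • 1, 0]
    (fun i => !![γ i, 0; 0, -γ i]))

theorem IsChirality.pauliExtend {γ : Fin n → A} {ω : A} (h : IsChirality γ ω) :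
    IsChirality (pauliExtend γ) !![ω, 0; 0, -ω] where
  sq := by simp [h.sq, Matrix.one_fin_two]
  anticomm := by
    simp [Fin.forall_fin_succ, _root_.pauliExtend, h.anticomm]

theorem IsCliffordSystem.adjoin_pauliExtend {γ : Fin n → A} (h : IsCliffordSystem γ) :
    Algebra.adjoin ℂ (Set.range (pauliExtend γ)) = ⊤ := by
  set S := Algebra.adjoin ℂ (Set.range (pauliExtend γ))
  have hmem (i) : pauliExtend γ i ∈ S := Algebra.subset_adjoin ⟨i, rfl⟩
  have hx : (!![0, 1; 1, 0] : Matrix (Fin 2) (Fin 2) A) ∈ S := hmem 0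
  have hz : (!![1, 0; 0, -1] : Matrix (Fin 2) (Fin 2) A) ∈ S := by
    have := S.smul_mem (S.mul_mem hx (hmem 1)) (-Complex.I)
    convert this using 1
    simp [pauliExtend, smul_smul]
  have h11 : (!![1, 0; 0, 0] : Matrix (Fin 2) (Fin 2) A) ∈ S := by
    have := S.smul_mem (S.add_mem S.one_mem hz) (1 / 2 : ℂ)
    convert this using 1
    simp [Matrix.one_fin_two, ← two_smul ℂ (1 : A)]
  have hdiag (a : A) : (!![a, 0; 0, a] : Matrix (Fin 2) (Fin 2) A) ∈ S := by
    have ha : a ∈ Algebra.adjoin ℂ (Set.range γ) := h.adjoin_range ▸ Algebra.mem_top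
    induction ha using Algebra.adjoin_induction with
    | mem x hx =>
      obtain ⟨i, rfl⟩ := hx
      have := S.mul_mem (hmem i.succ.succ) hz
      convert this using 1
      simp [pauliExtend]
    | algebraMap r =>
      convert S.algebraMap_mem r using 1
      ext i j
      fin_cases i <;> fin_cases j <;> simp [Matrix.algebraMap_matrix_apply]
    | add x y _ _ hx hy =>
      convert S.add_mem hx hy using 1
      simp
    | mul x y _ _ hx hy =>
      convert S.mul_mem hx hy using 1
      simp
  refine eq_top_iff.2 fun M _ => ?_
  have hM := S.add_mem
    (S.add_mem (S.mul_mem (hdiag (M 0 0)) h11) (S.mul_mem (hdiag (M 0 1)) (S.mul_mem h11 hx)))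
    (S.add_mem (S.mul_mem (hdiag (M 1 0)) (S.mul_mem hx h11))
      (S.mul_mem (hdiag (M 1 1)) (S.mul_mem hx (S.mul_mem h11 hx))))
  convert hM using 1
  ext i j
  fin_cases i <;> fin_cases j <;> simp

theorem IsCliffordSystem.pauliExtend {γ : Fin n → A} (h : IsCliffordSystem γ) :
    IsCliffordSystem (pauliExtend γ) where
  sq := by
    simp [Fin.forall_fin_succ, _root_.pauliExtend, h.sq, Matrix.one_fin_two,
      smul_smul]
  anticomm := by
    have hne (i j : Fin n) (hij : i ≠ j) := h.anticomm i j hij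
    simp +contextual [Fin.forall_fin_succ, _root_.pauliExtend, Fin.succ_ne_zero]
    exact hne
  adjoin_range := h.adjoin_pauliExtend

/-- A family in `A` together with a chirality element gives a family in `A × A` with one more
member. -/
def prodExtend (γ : Fin n → A) (ω : A) : Fin (n + 1) → A × A :=
  Fin.cons (ω, -ω) fun i => (γ i, γ i)

theorem IsCliffordSystem.prodExtend {γ : Fin n → A} {ω : A} (h : IsCliffordSystem γ)
    (hω : IsChirality γ ω) : IsCliffordSystem (prodExtend γ ω) where
  sq := by simp [Fin.forall_fin_succ, _root_.prodExtend, h.sq, hω.sq]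
  anticomm := by
    have hne (i j : Fin n) (hij : i ≠ j) := h.anticomm i j hij
    simp +contextual [Fin.forall_fin_succ, _root_.prodExtend, hω.anticomm, Fin.succ_ne_zero]
    exact hne
  adjoin_range := by
    set S := Algebra.adjoin ℂ (Set.range (_root_.prodExtend γ ω))
    have hmem (i) : _root_.prodExtend γ ω i ∈ S := Algebra.subset_adjoin ⟨i, rfl⟩
    have hdiag (a : A) : (a, a) ∈ S := by
      have ha : a ∈ Algebra.adjoin ℂ (Set.range γ) := h.adjoin_range ▸ Algebra.mem_top
      induction ha using Algebra.adjoin_induction with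
      | mem x hx =>
        obtain ⟨i, rfl⟩ := hx
        exact hmem i.succ
      | algebraMap r => exact S.algebraMap_mem r
      | add x y _ _ hx hy => exact S.add_mem hx hy
      | mul x y _ _ hx hy => exact S.mul_mem hx hy
    have hz : ((1, -1) : A × A) ∈ S := by
      have := S.mul_mem (hdiag ω) (hmem 0)
      simpa [_root_.prodExtend, hω.sq] using this
    have h1 : ((1, 0) : A × A) ∈ S := by
      have := S.smul_mem (S.add_mem S.one_mem hz) (1 / 2 : ℂ)
      convert this using 1
      ext
      · change (1 : A) = (1 / 2 : ℂ) • (1 + 1)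
        rw [← two_smul ℂ (1 : A), smul_smul]
        norm_num
      · simp
    refine eq_top_iff.2 fun x _ => ?_
    have hx := S.add_mem (S.mul_mem (hdiag (x.1 - x.2)) h1) (hdiag x.2)
    simpa using hx

end Doubling

theorem exists_isCliffordSystem_isChirality (k : ℕ) :
    ∃ (γ : Fin (2 * k) → Matrix (Fin (2 ^ k)) (Fin (2 ^ k)) ℂ)
      (ω : Matrix (Fin (2 ^ k)) (Fin (2 ^ k)) ℂ), IsCliffordSystem γ ∧ IsChirality γ ω := by
  induction k with
  | zero =>
    refine ⟨fun _ => 1, 1, ⟨fun i => i.elim0, fun i => i.elim0, ?_⟩, one_mul 1, fun i => i.elim0⟩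
    refine eq_top_iff.2 fun M _ => ?_
    convert Subalgebra.algebraMap_mem _ (M 0 0) using 1
    ext i j
    have hi (i : Fin (2 ^ 0)) : i = 0 := Subsingleton.elim (α := Fin 1) i 0
    simp [hi i, hi j, Matrix.algebraMap_matrix_apply]
  | succ k ih =>
    obtain ⟨γ, ω, h, hω⟩ := ih
    let e : Matrix (Fin 2) (Fin 2) (Matrix (Fin (2 ^ k)) (Fin (2 ^ k)) ℂ) ≃ₐ[ℂ]
        Matrix (Fin (2 ^ (k + 1))) (Fin (2 ^ (k + 1))) ℂ :=
      (Matrix.compAlgEquiv (Fin 2) (Fin (2 ^ k)) ℂ ℂ).trans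
        (Matrix.reindexAlgEquiv ℂ ℂ (finProdFinEquiv.trans (finCongr (pow_succ' 2 k).symm)))
    exact ⟨_, _, h.pauliExtend.map e, hω.pauliExtend.map e⟩

section Clifford

variable {A : Type*} [Ring A] [Algebra ℂ A] {n : ℕ}

theorem polar_Qc (v w : Fin n → ℂ) : QuadraticMap.polar (Qc n) v w = 2 * (v ⬝ᵥ w) := by
  simp only [QuadraticMap.polar, Qc, QuadraticMap.weightedSumSquares_apply, Pi.add_apply,
    one_smul, dotProduct, Finset.mul_sum, ← Finset.sum_sub_distrib]
  exact Finset.sum_congr rfl fun i _ => by ring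

theorem IsCliffordSystem.linearCombination_mul_self {γ : Fin n → A} (h : IsCliffordSystem γ)
    (m : Fin n → ℂ) : Fintype.linearCombination ℂ γ m * Fintype.linearCombination ℂ γ m =
      algebraMap ℂ A (Qc n m) := by
  have h2 : IsUnit (2 : A) := by
    simpa only [map_ofNat] using (IsUnit.mk0 (2 : ℂ) two_ne_zero).map (algebraMap ℂ A)
  revert m
  rw [CliffordAlgebra.forall_mul_self_eq_iff h2]
  ext i j
  rcases eq_or_ne i j with rfl | hij
  · simp [-QuadraticMap.polar_self, h.sq, polar_Qc, one_add_one_eq_two]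
    exact (map_ofNat (algebraMap ℂ A) 2).symm
  · simp [h.anticomm i j hij, polar_Qc, hij]

theorem finrank_cliffordAlgebra_Qc (n : ℕ) :
    Module.finrank ℂ (CliffordAlgebra (Qc n)) = 2 ^ n := by
  rw [(CliffordAlgebra.equivExterior (Qc n)).finrank_eq,
    Module.finrank_eq_card_basis (Pi.basisFun ℂ (Fin n)).ExteriorAlgebra, Fintype.card_finset,
    Fintype.card_fin]

theorem finite_cliffordAlgebra_Qc (n : ℕ) : Module.Finite ℂ (CliffordAlgebra (Qc n)) :=
  have := Module.Finite.of_basis (Pi.basisFun ℂ (Fin n)).ExteriorAlgebra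
  Module.Finite.equiv (CliffordAlgebra.equivExterior (Qc n)).symm

theorem IsCliffordSystem.nonempty_algEquiv {γ : Fin n → A} (h : IsCliffordSystem γ)
    [Module.Finite ℂ A] (hA : Module.finrank ℂ A = 2 ^ n) :
    Nonempty (CliffordAlgebra (Qc n) ≃ₐ[ℂ] A) := by
  have := finite_cliffordAlgebra_Qc n
  let f := CliffordAlgebra.lift (Qc n)
    ⟨Fintype.linearCombination ℂ γ, h.linearCombination_mul_self⟩
  have hf : Function.Surjective f := by
    rw [← AlgHom.range_eq_top, eq_top_iff, ← h.adjoin_range, Algebra.adjoin_le_iff]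
    rintro _ ⟨i, rfl⟩
    exact ⟨CliffordAlgebra.ι (Qc n) (Pi.single i 1), by simp [f]⟩
  have hinj : Function.Injective f :=
    (LinearMap.injective_iff_surjective_of_finrank_eq_finrank (f := f.toLinearMap)
      ((finrank_cliffordAlgebra_Qc n).trans hA.symm)).2 hf
  exact ⟨AlgEquiv.ofBijective f ⟨hinj, hf⟩⟩

end Clifford

/-- The odd complex Clifford algebra `ℂl_{2k+1}` is isomorphic as a `ℂ`-algebra to
`M_{2^k}(ℂ) × M_{2^k}(ℂ)`. -/
theorem odd_complex_clifford_iso_prod_matrix (k : ℕ) :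
    Nonempty (CliffordAlgebra (Qc (2 * k + 1)) ≃ₐ[ℂ]
      (Matrix (Fin (2 ^ k)) (Fin (2 ^ k)) ℂ × Matrix (Fin (2 ^ k)) (Fin (2 ^ k)) ℂ)) := by
  obtain ⟨γ, ω, h, hω⟩ := exists_isCliffordSystem_isChirality k
  refine (h.prodExtend hω).nonempty_algEquiv ?_
  rw [Module.finrank_prod, Module.finrank_matrix]
  simp
  ring
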